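/- arXiv:1505.03461 — 6 statements merged into one kernel-verified Lean document; each statement's English description precedes it below -/
import Mathlib

section
/- Let ε > 0, c > 0 and let κ > 0 satisfy κ·tanh(ε·κ) = c. Then κ < (1/ε)·(1/10 + ε·c/tanh(ε·c))·tanh(1/10 + ε·c/tanh(ε·c)). -/
theorem nonneg_of_deriv_nonneg {f f' : ℝ → ℝ} (hf : ∀ x, HasDerivAt f (f' x) x)
    (h0 : f 0 = 0) (hf' : ∀ x, 0 ≤ x → 0 ≤ f' x) {x : ℝ} (hx : 0 ≤ x) : 0 ≤ f x := by
  have hmono : MonotoneOn f (Set.Ici 0) := by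
    apply monotoneOn_of_deriv_nonneg (convex_Ici 0)
    · exact fun y _ => (hf y).continuousAt.continuousWithinAt
    · exact fun y _ => (hf y).differentiableAt.differentiableWithinAt
    · intro y hy
      rw [interior_Ici] at hy
      rw [(hf y).deriv]
      exact hf' y (le_of_lt hy)
  simpa [h0] using hmono Set.self_mem_Ici hx hx

open Real in
theorem sinh_le_mul_cosh {x : ℝ} (hx : 0 ≤ x) : 0 ≤ x * cosh x - sinh x := by
  refine nonneg_of_deriv_nonneg (f := fun x => x * cosh x - sinh x)
    (f' := fun x => x * sinh x) (fun x => ?_) (by simp)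
    (fun x hx => mul_nonneg hx (sinh_nonneg_iff.2 hx)) hx
  refine (((hasDerivAt_id' x).mul (hasDerivAt_cosh x)).sub (hasDerivAt_sinh x)).congr_deriv ?_
  ring

open Real in
theorem three_mul_cosh_le {x : ℝ} (hx : 0 ≤ x) :
    0 ≤ (3 + x ^ 2) * sinh x - 3 * x * cosh x := by
  refine nonneg_of_deriv_nonneg (f := fun x => (3 + x ^ 2) * sinh x - 3 * x * cosh x)
    (f' := fun x => x * (x * cosh x - sinh x)) (fun x => ?_) (by simp)
    (fun x hx => mul_nonneg hx (sinh_le_mul_cosh hx)) hx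
  refine ((((hasDerivAt_pow 2 x).const_add 3).mul (hasDerivAt_sinh x)).sub
    (((hasDerivAt_id' x).const_mul 3).mul (hasDerivAt_cosh x))).congr_deriv ?_
  push_cast
  ring

open Real in
theorem sinh_mul_le_cosh_mul {x : ℝ} (hx : 0 ≤ x) :
    0 ≤ (15 * x + x ^ 3) * cosh x - (15 + 6 * x ^ 2) * sinh x := by
  refine nonneg_of_deriv_nonneg
    (f := fun x => (15 * x + x ^ 3) * cosh x - (15 + 6 * x ^ 2) * sinh x)
    (f' := fun x => x * ((3 + x ^ 2) * sinh x - 3 * x * cosh x)) (fun x => ?_) (by simp)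
    (fun x hx => mul_nonneg hx (three_mul_cosh_le hx)) hx
  refine (((((hasDerivAt_id' x).const_mul 15).add (hasDerivAt_pow 3 x)).mul
    (hasDerivAt_cosh x)).sub
    ((((hasDerivAt_pow 2 x).const_mul 6).const_add 15).mul (hasDerivAt_sinh x))).congr_deriv ?_
  simp only [Pi.add_apply]
  push_cast
  ring

open Real in
theorem cosh_mul_le_sinh_mul {x : ℝ} (hx : 0 ≤ x) :
    0 ≤ (105 + 45 * x ^ 2 + x ^ 4) * sinh x - (105 * x + 10 * x ^ 3) * cosh x := by
  refine nonneg_of_deriv_nonneg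
    (f := fun x => (105 + 45 * x ^ 2 + x ^ 4) * sinh x - (105 * x + 10 * x ^ 3) * cosh x)
    (f' := fun x => x * ((15 * x + x ^ 3) * cosh x - (15 + 6 * x ^ 2) * sinh x))
    (fun x => ?_) (by simp)
    (fun x hx => mul_nonneg hx (sinh_mul_le_cosh_mul hx)) hx
  refine ((((((hasDerivAt_pow 2 x).const_mul 45).const_add 105).add
    (hasDerivAt_pow 4 x)).mul (hasDerivAt_sinh x)).sub
    ((((hasDerivAt_id' x).const_mul 105).add ((hasDerivAt_pow 3 x).const_mul 10)).mul
    (hasDerivAt_cosh x))).congr_deriv ?_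
  simp only [Pi.add_apply]
  push_cast
  ring

theorem tanh_pos {x : ℝ} (hx : 0 < x) : 0 < Real.tanh x := by
  rw [Real.tanh_eq_sinh_div_cosh]
  exact div_pos (Real.sinh_pos_iff.2 hx) (Real.cosh_pos x)

theorem tanh_strictMono : StrictMono Real.tanh := by
  intro x y hxy
  rw [Real.tanh_eq_sinh_div_cosh, Real.tanh_eq_sinh_div_cosh,
    div_lt_div_iff₀ (Real.cosh_pos x) (Real.cosh_pos y)]
  have h := Real.sinh_pos_iff.2 (sub_pos.2 hxy)
  rw [Real.sinh_sub] at h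
  linarith

/-- A Padé lower bound for `x * tanh x`. -/
theorem pade_le_mul_tanh {x : ℝ} (hx : 0 ≤ x) :
    x * (105 * x + 10 * x ^ 3) / (105 + 45 * x ^ 2 + x ^ 4) ≤ x * Real.tanh x := by
  rw [mul_div_assoc]
  refine mul_le_mul_of_nonneg_left ?_ hx
  rw [Real.tanh_eq_sinh_div_cosh, div_le_div_iff₀ (by positivity) (Real.cosh_pos x)]
  linarith [cosh_mul_le_sinh_mul hx]

/-- A Padé lower bound for `x * coth x`. -/
theorem pade_le_div_tanh {x : ℝ} (hx : 0 < x) :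
    (15 + 6 * x ^ 2) / (15 + x ^ 2) ≤ x / Real.tanh x := by
  have hs := Real.sinh_pos_iff.2 hx
  rw [Real.tanh_eq_sinh_div_cosh, div_div_eq_mul_div, div_le_div_iff₀ (by positivity) hs]
  linarith [sinh_mul_le_cosh_mul hx.le]

/-- A linear lower bound for `x * tanh x`, nearly sharp on the given interval. -/
theorem linear_le_mul_tanh {x : ℝ} (h1 : 87 / 100 ≤ x) (h2 : x ≤ 186 / 100) :
    47 / 40 * x - 83 / 200 ≤ x * Real.tanh x := by
  refine le_trans ?_ (pade_le_mul_tanh (by linarith))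
  rw [le_div_iff₀ (by positivity)]
  have ha : 0 ≤ x - 87 / 100 := by linarith
  have hb : 0 ≤ 186 / 100 - x := by linarith
  nlinarith [mul_nonneg hb (sq_nonneg (x - 95 / 100)),
    mul_nonneg ha (sq_nonneg (x - 95 / 100)),
    mul_nonneg hb (sq_nonneg ((x - 95 / 100) * (x - 186 / 100))),
    mul_nonneg ha (sq_nonneg ((x - 95 / 100) * (x - 186 / 100))),
    mul_nonneg (mul_nonneg ha hb) (sq_nonneg (x - 95 / 100)),
    mul_nonneg hb (sq_nonneg ((x - 95 / 100) * x)),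
    mul_nonneg ha (sq_nonneg ((x - 95 / 100) * x)), sq_nonneg (x - 95 / 100)]

theorem mul_tanh_lt_mul_tanh {x y : ℝ} (hx : 0 < x) (hxy : x < y) :
    x * Real.tanh x < y * Real.tanh y :=
  mul_lt_mul'' hxy (tanh_strictMono hxy) hx.le (tanh_pos hx).le

theorem sub_le_mul_tanh {z : ℝ} (hz : 37 / 20 ≤ z) : z - 1 / 10 ≤ z * Real.tanh z := by
  have hexp : (36 : ℝ) ≤ Real.exp (37 / 10) := by
    have h : (36 : ℝ) ^ 10 ≤ Real.exp (37 / 10) ^ 10 := by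
      rw [← Real.exp_nat_mul]
      have h37 : ((10 : ℕ) : ℝ) * (37 / 10) = ((37 : ℕ) : ℝ) * 1 := by norm_num
      rw [h37, Real.exp_nat_mul]
      calc (36 : ℝ) ^ 10 ≤ 2.718 ^ 37 := by norm_num
        _ ≤ Real.exp 1 ^ 37 :=
          pow_le_pow_left₀ (by norm_num) (by linarith [Real.exp_one_gt_d9]) _
    exact le_of_pow_le_pow_left₀ (by norm_num) (Real.exp_pos _).le h
  have hz2 : 20 * z ≤ Real.exp (2 * z) + 1 := by
    have h : Real.exp (2 * z) = Real.exp (37 / 10) * Real.exp (2 * z - 37 / 10) := by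
      rw [← Real.exp_add]; congr 1; ring
    have h1 := Real.add_one_le_exp (2 * z - 37 / 10)
    have h2 := mul_le_mul hexp h1 (by linarith) (Real.exp_pos _).le
    linarith
  have htanh : Real.tanh z = 1 - 2 / (Real.exp (2 * z) + 1) := by
    have h : Real.exp (2 * z) = Real.exp z * Real.exp z := by
      rw [← Real.exp_add]; congr 1; ring
    have hp := Real.exp_pos z
    rw [Real.tanh_eq, Real.exp_neg, h]
    field_simp
    ring
  have hle : 2 * z / (Real.exp (2 * z) + 1) ≤ 1 / 10 := by
    rw [div_le_div_iff₀ (by positivity) (by norm_num)]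
    linarith
  have hz3 : z * Real.tanh z = z - 2 * z / (Real.exp (2 * z) + 1) := by
    rw [htanh]; ring
  linarith

/-- The bound in the dimensionless variable `x = ε * κ`. -/
theorem lt_mul_tanh_add_div_tanh {x t : ℝ} (hx : 0 < x) (ht : x * Real.tanh x = t) :
    x < (1 / 10 + t / Real.tanh t) * Real.tanh (1 / 10 + t / Real.tanh t) := by
  have hxt := tanh_pos hx
  have ht0 : 0 < t := ht ▸ mul_pos hx hxt
  have hpade := pade_le_div_tanh ht0
  rcases lt_or_ge x (87 / 100) with h1 | h1
  · have hF : 1 ≤ t / Real.tanh t := by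
      refine le_trans ?_ hpade
      rw [le_div_iff₀ (by positivity)]
      nlinarith [sq_nonneg t]
    have hlin := linear_le_mul_tanh (x := 1.099) (by norm_num) (by norm_num)
    have hlt := mul_tanh_lt_mul_tanh (x := 1.099) (y := 1 / 10 + t / Real.tanh t)
      (by norm_num) (by linarith)
    linarith
  rcases le_or_gt x (7 / 4) with h2 | h2
  · have hL : 47 / 40 * x - 83 / 200 ≤ t :=
      ht ▸ linear_le_mul_tanh h1 (by linarith)
    have htx : t < x := by
      rw [← ht]
      nlinarith [Real.tanh_lt_one x]
    have hF : 40 / 47 * (x + 83 / 200) - 1 / 10 < t / Real.tanh t := by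
      refine lt_of_lt_of_le ?_ hpade
      have hle : 40 / 47 * (x + 83 / 200) - 1 / 10
          ≤ 40 / 47 * (40 / 47 * (t + 83 / 200) + 83 / 200) - 1 / 10 := by linarith
      refine lt_of_le_of_lt hle ?_
      rw [lt_div_iff₀ (by positivity)]
      nlinarith [mul_nonneg ht0.le (sq_nonneg (t - 14 / 10)), sq_nonneg (t - 14 / 10)]
    have hlin := linear_le_mul_tanh (x := 40 / 47 * (x + 83 / 200))
      (by linarith) (by linarith)
    have hlt := mul_tanh_lt_mul_tanh (x := 40 / 47 * (x + 83 / 200))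
      (y := 1 / 10 + t / Real.tanh t) (by linarith) (by linarith)
    linarith
  · have htx : t < x := by
      rw [← ht]
      nlinarith [Real.tanh_lt_one x]
    have hF : x < t / Real.tanh t := by
      rw [lt_div_iff₀ (tanh_pos ht0)]
      calc x * Real.tanh t < x * Real.tanh x :=
            mul_lt_mul_of_pos_left (tanh_strictMono htx) hx
        _ = t := ht
    have hsub := sub_le_mul_tanh (z := x + 1 / 10) (by linarith)
    have hlt := mul_tanh_lt_mul_tanh (x := x + 1 / 10) (y := 1 / 10 + t / Real.tanh t)
      (by linarith) (by linarith)
    linarith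


/-- If κ > 0 satisfies the spectral equation κ·tanh(ε·κ) = c with ε, c > 0,
    then κ < (1/ε)·(1/10 + εc/tanh(εc))·tanh(1/10 + εc/tanh(εc)). -/
theorem stmt_2 (ε c κ : ℝ) (hε : 0 < ε) (hc : 0 < c) (hκ : 0 < κ)
    (hspec : κ * Real.tanh (ε * κ) = c) :
    κ < (1 / ε) * (1 / 10 + ε * c / Real.tanh (ε * c)) *
        Real.tanh (1 / 10 + ε * c / Real.tanh (ε * c)) := by
  have h := lt_mul_tanh_add_div_tanh (x := ε * κ) (t := ε * c) (mul_pos hε hκ)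
    (by rw [mul_assoc, hspec])
  rw [mul_assoc, one_div_mul_eq_div, lt_div_iff₀ hε, mul_comm κ ε]
  exact h
end

section
/- Let ε > 0, c > 0 and let κ > 0 satisfy κ·tanh(ε·κ) = c. Then for every continuously differentiable function φ : [0, ε] → ℝ one has ∫₀^ε φ′(x)² dx − c·φ(ε)² ≥ −κ² · ∫₀^ε φ(x)² dx. -/
theorem hasDerivAt_mul_sinh_div_cosh (κ x : ℝ) :
    HasDerivAt (fun x => κ * (Real.sinh (x * κ) / Real.cosh (x * κ)))
      (κ ^ 2 - (κ * (Real.sinh (x * κ) / Real.cosh (x * κ))) ^ 2) x := by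
  have hlin : HasDerivAt (fun x : ℝ => x * κ) κ x := by
    simpa using (hasDerivAt_id x).mul_const κ
  have hcosh : Real.cosh (x * κ) ≠ 0 := (Real.cosh_pos _).ne'
  refine ((hlin.sinh.div hlin.cosh hcosh).const_mul κ).congr_deriv ?_
  field_simp

/-- If `T` solves the Riccati equation `T' = a - T²` with continuous `T`, then the quadratic form
`∫ φ'² + a ∫ φ²` dominates the boundary terms `T φ²`. -/
theorem riccati_boundary_le {T φ : ℝ → ℝ} {a s t : ℝ} (hst : s ≤ t)
    (hT : ∀ x, HasDerivAt T (a - T x ^ 2) x) (hφ : ContDiff ℝ 1 φ) :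
    T t * φ t ^ 2 - T s * φ s ^ 2 ≤
      (∫ x in s..t, deriv φ x ^ 2) + a * ∫ x in s..t, φ x ^ 2 := by
  have hcT : Continuous T := continuous_iff_continuousAt.2 fun x => (hT x).continuousAt
  have hcφ : Continuous φ := hφ.continuous
  have hcφ' : Continuous (deriv φ) := hφ.continuous_deriv le_rfl
  have hint : IntervalIntegrable (fun x => deriv φ x ^ 2) MeasureTheory.volume s t :=
    (hcφ'.pow 2).intervalIntegrable s t
  have hint' : IntervalIntegrable (fun x => a * φ x ^ 2) MeasureTheory.volume s t :=
    (continuous_const.mul (hcφ.pow 2)).intervalIntegrable s t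
  have hderiv (x : ℝ) : HasDerivAt (fun x => T x * φ x ^ 2)
      ((a - T x ^ 2) * φ x ^ 2 + T x * (2 * φ x * deriv φ x)) x := by
    have h := ((hφ.differentiable one_ne_zero) x).hasDerivAt
    refine ((hT x).mul (h.pow 2)).congr_deriv ?_
    simp
  have hcont : Continuous fun x => (a - T x ^ 2) * φ x ^ 2 + T x * (2 * φ x * deriv φ x) := by
    fun_prop
  rw [← intervalIntegral.integral_eq_sub_of_hasDerivAt (fun x _ => hderiv x)
      (hcont.intervalIntegrable s t),
    ← intervalIntegral.integral_const_mul, ← intervalIntegral.integral_add hint hint']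
  refine intervalIntegral.integral_mono_on hst (hcont.intervalIntegrable s t)
    (hint.add hint') fun x _ => ?_
  nlinarith [sq_nonneg (deriv φ x - T x * φ x)]

/-- One-dimensional lower bound for the Robin quadratic form: if κ > 0 solves
    κ·tanh(ε·κ) = c, then for every C¹ function φ,
    ∫₀^ε φ′(x)² dx − c·φ(ε)² ≥ −κ²·∫₀^ε φ(x)² dx. -/
theorem stmt_3 (ε c κ : ℝ) (hε : 0 < ε) (hc : 0 < c) (hκ : 0 < κ)
    (hspec : κ * Real.tanh (ε * κ) = c)
    (φ : ℝ → ℝ) (hφ : ContDiff ℝ 1 φ) :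
    (∫ x in (0:ℝ)..ε, (deriv φ x) ^ 2) - c * (φ ε) ^ 2 ≥
      -κ ^ 2 * ∫ x in (0:ℝ)..ε, (φ x) ^ 2 := by
  have h := riccati_boundary_le hε.le (hasDerivAt_mul_sinh_div_cosh κ) hφ
  rw [Real.tanh_eq_sinh_div_cosh] at hspec
  rw [hspec] at h
  simp only [zero_mul, Real.sinh_zero, zero_div, mul_zero, sub_zero] at h
  linarith
end

section
/- Let ε > 0 and let κ : (0, ∞) → ℝ be a function such that for every c > 0 one has κ(c) > 0 and κ(c)·tanh(ε·κ(c)) = c. Then κ(c)·√(ε/c) tends to 1 as c → 0⁺. -/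
theorem Real.sinh_le_self_mul_cosh {x : ℝ} (hx : 0 ≤ x) :
    Real.sinh x ≤ x * Real.cosh x := by
  have hd : ∀ y : ℝ, HasDerivAt (fun y => y * Real.cosh y - Real.sinh y) (y * Real.sinh y) y := by
    intro y
    have h := ((hasDerivAt_id' y).fun_mul (Real.hasDerivAt_cosh y)).fun_sub (Real.hasDerivAt_sinh y)
    exact h.congr_deriv (by ring)
  have hmono : MonotoneOn (fun y => y * Real.cosh y - Real.sinh y) (Set.Ici 0) := by
    refine monotoneOn_of_deriv_nonneg (convex_Ici 0)
      (fun y _ => (hd y).continuousAt.continuousWithinAt)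
      (fun y _ => (hd y).differentiableAt.differentiableWithinAt) fun y hy => ?_
    have hy0 : 0 ≤ y := interior_subset hy
    rw [(hd y).deriv]
    exact mul_nonneg hy0 (Real.sinh_nonneg_iff.2 hy0)
  have h := hmono (Set.mem_Ici.2 le_rfl) (Set.mem_Ici.2 hx) hx
  simp only [zero_mul, Real.sinh_zero, sub_zero] at h
  linarith

theorem Real.tanh_le_self_of_nonneg {x : ℝ} (hx : 0 ≤ x) : Real.tanh x ≤ x := by
  rw [Real.tanh_eq_sinh_div_cosh, div_le_iff₀ (Real.cosh_pos x)]
  exact Real.sinh_le_self_mul_cosh hx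

theorem Real.self_le_one_add_mul_tanh {x : ℝ} (hx : 0 ≤ x) :
    x ≤ (1 + x) * Real.tanh x := by
  rw [Real.tanh_eq_sinh_div_cosh, ← mul_div_assoc, le_div_iff₀ (Real.cosh_pos x)]
  have h1 : x ≤ Real.sinh x := Real.self_le_sinh_iff.2 hx
  have h2 : Real.cosh x - Real.sinh x ≤ 1 := by
    rw [Real.cosh_sub_sinh]
    exact Real.exp_le_one_iff.2 (neg_nonpos.2 hx)
  nlinarith [mul_le_mul_of_nonneg_left h2 hx]

/-- Asymptotics of the edge-state decay rate: if κ(c) > 0 solves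
    κ(c)·tanh(ε·κ(c)) = c for every c > 0, then κ(c)·√(ε/c) → 1 as c → 0⁺. -/
theorem stmt_7 (ε : ℝ) (hε : 0 < ε) (κ : ℝ → ℝ)
    (hκ : ∀ c : ℝ, 0 < c → 0 < κ c ∧ κ c * Real.tanh (ε * κ c) = c) :
    Filter.Tendsto (fun c => κ c * Real.sqrt (ε / c))
      (nhdsWithin 0 (Set.Ioi 0)) (nhds 1) := by
  have hbounds : ∀ c : ℝ, 0 < c → 1 ≤ κ c * √(ε / c) ∧
      κ c * √(ε / c) ≤ 1 + (ε * c + √(ε * c)) := by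
    intro c hc
    obtain ⟨hk, hkc⟩ := hκ c hc
    have hx : 0 < ε * κ c := mul_pos hε hk
    have hlow : c ≤ κ c ^ 2 * ε := by
      have := mul_le_mul_of_nonneg_left (Real.tanh_le_self_of_nonneg hx.le) hk.le
      nlinarith
    have hup : κ c ^ 2 * ε ≤ c * (1 + ε * κ c) := by
      have := mul_le_mul_of_nonneg_left (Real.self_le_one_add_mul_tanh hx.le) hk.le
      calc κ c ^ 2 * ε = κ c * (ε * κ c) := by ring
        _ ≤ κ c * ((1 + ε * κ c) * Real.tanh (ε * κ c)) := this
        _ = (κ c * Real.tanh (ε * κ c)) * (1 + ε * κ c) := by ring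
        _ = c * (1 + ε * κ c) := by rw [hkc]
    have hsq : (κ c * √(ε / c)) ^ 2 = κ c ^ 2 * ε / c := by
      rw [mul_pow, Real.sq_sqrt (by positivity), mul_div_assoc]
    have hnonneg : 0 ≤ κ c * √(ε / c) := by positivity
    have hone : 1 ≤ κ c * √(ε / c) := by
      rw [← one_le_sq_iff₀ hnonneg, hsq, one_le_div hc]
      exact hlow
    have hle : (κ c * √(ε / c)) ^ 2 ≤ 1 + ε * κ c := by
      rw [hsq, div_le_iff₀ hc]
      linarith
    have hxt : ε * κ c ≤ ε * c + √(ε * c) := by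
      have ht : 0 < ε * c := mul_pos hε hc
      have hs : 0 < √(ε * c) := Real.sqrt_pos.2 ht
      have hss : √(ε * c) * √(ε * c) = ε * c := Real.mul_self_sqrt ht.le
      have hquad : (ε * κ c) * (ε * κ c - ε * c) ≤ ε * c := by
        nlinarith [mul_le_mul_of_nonneg_left hup hε.le]
      by_contra! h
      have h1 : √(ε * c) < ε * κ c - ε * c := by linarith
      have h2 : √(ε * c) < ε * κ c := by linarith
      have := mul_lt_mul'' h2 h1 hs.le hs.le
      linarith
    exact ⟨hone, by nlinarith⟩
  have hlim : Filter.Tendsto (fun c : ℝ => 1 + (ε * c + √(ε * c)))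
      (nhdsWithin 0 (Set.Ioi 0)) (nhds 1) := by
    have hcont : Continuous fun c : ℝ => 1 + (ε * c + √(ε * c)) := by fun_prop
    simpa using (hcont.tendsto 0).mono_left nhdsWithin_le_nhds
  refine tendsto_of_tendsto_of_tendsto_of_le_of_le' tendsto_const_nhds hlim ?_ ?_
  · filter_upwards [self_mem_nhdsWithin] with c hc using (hbounds c hc).1
  · filter_upwards [self_mem_nhdsWithin] with c hc using (hbounds c hc).2
end

section
/- Let ε > 0, c > 0, let κ > 0 satisfy κ·tanh(ε·κ) = c, and let m be a real number with m² ≥ κ². Then for every continuously differentiable function φ : [0, ε] → ℝ one has ∫₀^ε φ′(x)² dx + m² · ∫₀^ε φ(x)² dx − c·φ(ε)² ≥ 0. -/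
/-- The function `x ↦ κ tanh (x κ)` solves the Riccati equation `w' = κ² - w²`. -/
theorem hasDerivAt_mul_tanh_mul (κ x : ℝ) :
    HasDerivAt (fun y => κ * Real.tanh (y * κ)) (κ ^ 2 - (κ * Real.tanh (x * κ)) ^ 2) x := by
  have hcosh := (Real.cosh_pos (x * κ)).ne'
  have hlin : HasDerivAt (fun y : ℝ => y * κ) κ x := by
    simpa using (hasDerivAt_id x).mul_const κ
  have h := ((hlin.sinh.div hlin.cosh hcosh).const_mul κ)
  simp only [Real.tanh_eq_sinh_div_cosh]
  refine h.congr_deriv ?_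
  field_simp

/-- One-dimensional stability criterion: if κ > 0 solves κ·tanh(ε·κ) = c and
    m² ≥ κ², then the massive Robin quadratic form is non-negative. -/
theorem stmt_10 (ε c κ m : ℝ) (hε : 0 < ε) (hc : 0 < c) (hκ : 0 < κ)
    (hspec : κ * Real.tanh (ε * κ) = c) (hm : m ^ 2 ≥ κ ^ 2)
    (φ : ℝ → ℝ) (hφ : ContDiff ℝ 1 φ) :
    (∫ x in (0:ℝ)..ε, (deriv φ x) ^ 2)
      + m ^ 2 * (∫ x in (0:ℝ)..ε, (φ x) ^ 2) - c * (φ ε) ^ 2 ≥ 0 := by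
  have hφc : Continuous φ := hφ.continuous
  have hφ'c : Continuous (deriv φ) := hφ.continuous_deriv le_rfl
  set w : ℝ → ℝ := fun y => κ * Real.tanh (y * κ) with hw
  have hw' (x : ℝ) : HasDerivAt w (κ ^ 2 - w x ^ 2) x := hasDerivAt_mul_tanh_mul κ x
  have hwc : Continuous w := continuous_iff_continuousAt.2 fun x => (hw' x).continuousAt
  have hderiv (x : ℝ) : HasDerivAt (fun y => w y * φ y ^ 2)
      ((κ ^ 2 - w x ^ 2) * φ x ^ 2 + 2 * w x * φ x * deriv φ x) x := by
    have hφx := (hφ.differentiable one_ne_zero x).hasDerivAt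
    refine ((hw' x).mul (hφx.pow 2)).congr_deriv ?_
    simp
    ring
  have hftc := intervalIntegral.integral_eq_sub_of_hasDerivAt (a := 0) (b := ε)
    (fun x _ => hderiv x) (Continuous.intervalIntegrable (by fun_prop) _ _)
  have hle : (∫ x in (0:ℝ)..ε,
        ((κ ^ 2 - w x ^ 2) * φ x ^ 2 + 2 * w x * φ x * deriv φ x))
      ≤ ∫ x in (0:ℝ)..ε, (deriv φ x ^ 2 + m ^ 2 * φ x ^ 2) := by
    refine intervalIntegral.integral_mono_on hε.le
      (Continuous.intervalIntegrable (by fun_prop) _ _)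
      (Continuous.intervalIntegrable (by fun_prop) _ _) fun x _ => ?_
    nlinarith [sq_nonneg (deriv φ x - w x * φ x), mul_le_mul_of_nonneg_right hm (sq_nonneg (φ x))]
  rw [hftc, intervalIntegral.integral_add (Continuous.intervalIntegrable (by fun_prop) _ _)
    (Continuous.intervalIntegrable (by fun_prop) _ _), intervalIntegral.integral_const_mul] at hle
  have hw0 : w 0 = 0 := by simp [hw]
  have hwε : w ε = c := hspec
  rw [hw0, hwε] at hle
  linarith
end

section
/- Let ε > 0 and Λ > 0, and define g(x) = exp(−(2εΛ/π)·tan(πx/(2ε))) for x ∈ [0, ε). Then g(0) = 1, g′(0) = −Λ, and the improper integral ∫₀^ε g′(x)² dx converges and equals Λ/2 + π²/(16·ε²·Λ). -/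
open MeasureTheory

open Filter Topology Set in
/-- A nonnegative derivative of a function with finite limits at the endpoints is integrable, and
its integral is the difference of the limits. -/
theorem integrableOn_and_integral_Ioo_of_hasDerivAt_of_nonneg {f f' : ℝ → ℝ} {a b c d : ℝ}
    (hab : a < b) (hderiv : ∀ x ∈ Ioo a b, HasDerivAt f (f' x) x) (hpos : ∀ x ∈ Ioo a b, 0 ≤ f' x)
    (ha : Tendsto f (𝓝[>] a) (𝓝 c)) (hb : Tendsto f (𝓝[<] b) (𝓝 d)) :
    IntegrableOn f' (Ioo a b) ∧ ∫ x in Ioo a b, f' x = d - c := by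
  have hcont : ContinuousOn (extendFrom (Ioo a b) f) (Icc a b) :=
    continuousOn_Icc_extendFrom_Ioo
      (fun x hx => (hderiv x hx).continuousAt.continuousWithinAt) ha hb
  have heq : ∀ x ∈ Ioo a b, extendFrom (Ioo a b) f x = f x := fun x hx =>
    extendFrom_eq (subset_closure hx) ((hderiv x hx).continuousAt.continuousWithinAt)
  have hint : IntegrableOn f' (Ioc a b) :=
    intervalIntegral.integrableOn_deriv_of_nonneg hcont
      (fun x hx => (hderiv x hx).congr_of_eventuallyEq
        (eventually_of_mem (Ioo_mem_nhds hx.1 hx.2) heq)) hpos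
  refine ⟨hint.mono_set Ioo_subset_Ioc_self, ?_⟩
  rw [← integral_Ioc_eq_integral_Ioo, ← intervalIntegral.integral_of_le hab.le]
  exact intervalIntegral.integral_eq_sub_of_hasDerivAt_of_tendsto hab hderiv
    ((intervalIntegrable_iff_integrableOn_Ioc_of_le hab.le).2 hint) ha hb

/-- An antiderivative of `c * k * (1 + t ^ 2) * exp (-2 * k * t)`. -/
theorem hasDerivAt_quadratic_mul_exp (c : ℝ) {k : ℝ} (hk : k ≠ 0) (t : ℝ) :
    HasDerivAt (fun t => -c * (t ^ 2 / 2 + t / (2 * k) + 1 / (4 * k ^ 2) + 1 / 2) *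
      Real.exp (-2 * k * t)) (c * k * (1 + t ^ 2) * Real.exp (-2 * k * t)) t := by
  have hp : HasDerivAt (fun t : ℝ => -c * (t ^ 2 / 2 + t / (2 * k) + 1 / (4 * k ^ 2) + 1 / 2))
      (-c * (t + 1 / (2 * k))) t := by
    refine ((((((hasDerivAt_id t).pow 2).div_const 2).add
      ((hasDerivAt_id t).div_const (2 * k))).add_const (1 / (4 * k ^ 2))).add_const
        (1 / 2)).const_mul (-c) |>.congr_deriv ?_
    simp
  have he := ((hasDerivAt_id t).const_mul (-2 * k)).exp
  refine (hp.mul he).congr_deriv ?_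
  simp only [id]
  field_simp
  ring

open Filter Topology in
theorem tendsto_quadratic_mul_exp_atTop (c : ℝ) {k : ℝ} (hk : 0 < k) :
    Tendsto (fun t : ℝ => -c * (t ^ 2 / 2 + t / (2 * k) + 1 / (4 * k ^ 2) + 1 / 2) *
      Real.exp (-2 * k * t)) atTop (𝓝 0) := by
  have hlin : Tendsto (fun t : ℝ => 2 * k * t) atTop atTop :=
    tendsto_id.const_mul_atTop (by positivity)
  have h (n : ℕ) := (Real.tendsto_pow_mul_exp_neg_atTop_nhds_zero n).comp hlin
  have hsum := (((h 2).const_mul (-c / (8 * k ^ 2))).add ((h 1).const_mul (-c / (4 * k ^ 2)))).add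
    ((h 0).const_mul (-c * (1 / (4 * k ^ 2) + 1 / 2)))
  simp only [mul_zero, add_zero] at hsum
  refine hsum.congr fun t => ?_
  simp only [Function.comp_apply, neg_mul]
  field_simp
  ring

theorem hasDerivAt_tan_pi_mul_div {ε x : ℝ} (hx : Real.cos (Real.pi * x / (2 * ε)) ≠ 0) :
    HasDerivAt (fun x => Real.tan (Real.pi * x / (2 * ε)))
      (Real.pi / (2 * ε) * (1 + Real.tan (Real.pi * x / (2 * ε)) ^ 2)) x := by
  have hlin : HasDerivAt (fun x => Real.pi * x / (2 * ε)) (Real.pi / (2 * ε)) x := by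
    simpa using ((hasDerivAt_id x).const_mul Real.pi).div_const (2 * ε)
  refine ((Real.hasDerivAt_tan hx).comp x hlin).congr_deriv ?_
  rw [← Real.inv_one_add_tan_sq hx, one_div, inv_inv, mul_comm]

open Filter Topology in
theorem tendsto_tan_pi_mul_div {ε : ℝ} (hε : 0 < ε) :
    Tendsto (fun x => Real.tan (Real.pi * x / (2 * ε))) (𝓝[<] ε) atTop := by
  refine Real.tendsto_tan_pi_div_two.comp (tendsto_nhdsWithin_iff.2 ⟨?_, ?_⟩)
  · have h : ContinuousAt (fun x => Real.pi * x / (2 * ε)) ε := by fun_prop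
    have hval : Real.pi * ε / (2 * ε) = Real.pi / 2 := by field_simp
    have := h.tendsto
    rw [hval] at this
    exact this.mono_left nhdsWithin_le_nhds
  · filter_upwards [self_mem_nhdsWithin] with x hx
    rw [Set.mem_Iio, div_lt_div_iff₀ (by positivity) two_pos]
    nlinarith [mul_lt_mul_of_pos_left (Set.mem_Iio.1 hx) Real.pi_pos]

/-- The radial profile g(x) = exp(−(2εΛ/π)·tan(πx/(2ε))) of the APS trial
    spinor satisfies g(0) = 1, g′(0) = −Λ, and the improper integral of g′²
    over (0,ε) converges, with value Λ/2 + π²/(16ε²Λ). -/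
theorem stmt_13 (ε Λ : ℝ) (hε : 0 < ε) (hΛ : 0 < Λ) :
    let g : ℝ → ℝ := fun x =>
      Real.exp (-(2 * ε * Λ / Real.pi) * Real.tan (Real.pi * x / (2 * ε)))
    g 0 = 1 ∧ deriv g 0 = -Λ ∧
    IntegrableOn (fun x => (deriv g x) ^ 2) (Set.Ioo 0 ε) ∧
    (∫ x in Set.Ioo 0 ε, (deriv g x) ^ 2)
      = Λ / 2 + Real.pi ^ 2 / (16 * ε ^ 2 * Λ) := by
  intro g
  have hπ := Real.pi_pos
  set k : ℝ := 2 * ε * Λ / Real.pi with hk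
  have hk0 : 0 < k := by positivity
  have hslope : Real.pi / (2 * ε) = Λ / k := by rw [hk]; field_simp
  set T : ℝ → ℝ := fun x => Real.tan (Real.pi * x / (2 * ε)) with hT
  have hT0 : T 0 = 0 := by simp [hT]
  have hcos : ∀ x ∈ Set.Ico 0 ε, Real.cos (Real.pi * x / (2 * ε)) ≠ 0 := fun x hx => by
    refine (Real.cos_pos_of_mem_Ioo ⟨?_, ?_⟩).ne'
    · have : 0 ≤ Real.pi * x / (2 * ε) := div_nonneg (mul_nonneg hπ.le hx.1) (by positivity)
      linarith
    · rw [div_lt_div_iff₀ (by positivity) two_pos]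
      nlinarith [mul_lt_mul_of_pos_left hx.2 hπ]
  have hTderiv : ∀ x ∈ Set.Ico 0 ε, HasDerivAt T (Λ / k * (1 + T x ^ 2)) x := fun x hx => by
    rw [← hslope]
    exact hasDerivAt_tan_pi_mul_div (hcos x hx)
  have hg : ∀ x ∈ Set.Ico 0 ε, deriv g x = -Λ * (1 + T x ^ 2) * Real.exp (-k * T x) :=
    fun x hx => by
      refine (((hTderiv x hx).const_mul (-k)).exp.congr_deriv ?_).deriv
      field_simp
  have h0 : (0 : ℝ) ∈ Set.Ico 0 ε := ⟨le_rfl, hε⟩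
  refine ⟨by simp [g], by simp [hg 0 h0, hT0], ?_⟩
  set P : ℝ → ℝ := fun t => -Λ * (t ^ 2 / 2 + t / (2 * k) + 1 / (4 * k ^ 2) + 1 / 2) *
    Real.exp (-2 * k * t) with hP
  have hPT : ∀ x ∈ Set.Ico 0 ε, HasDerivAt (P ∘ T) (deriv g x ^ 2) x := fun x hx => by
    refine ((hasDerivAt_quadratic_mul_exp Λ hk0.ne' (T x)).comp x (hTderiv x hx)).congr_deriv ?_
    have hexp : Real.exp (-2 * k * T x) = Real.exp (-k * T x) ^ 2 := by
      rw [← Real.exp_nat_mul]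
      push_cast
      ring_nf
    rw [hg x hx, hexp]
    field_simp
  have key := integrableOn_and_integral_Ioo_of_hasDerivAt_of_nonneg hε
    (fun x hx => hPT x (Set.Ioo_subset_Ico_self hx)) (fun x _ => sq_nonneg (deriv g x))
    ((hPT 0 h0).continuousAt.tendsto.mono_left nhdsWithin_le_nhds)
    ((tendsto_quadratic_mul_exp_atTop Λ hk0).comp (tendsto_tan_pi_mul_div hε))
  refine ⟨key.1, key.2.trans ?_⟩
  simp only [Function.comp_apply, hT0, hP, hk]
  simp
  field_simp
  ring
end

section
/- Let ε > 0 and Λ > 0, and define g(x) = exp(−(2εΛ/π)·tan(πx/(2ε))) for x ∈ [0, ε). Then ∫₀^ε g′(x)² dx − Λ·g(0)² < 0 if and only if 8·ε²·Λ² > π², i.e. if and only if Λ > π/(2√2·ε). -/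
open MeasureTheory

open Set Filter Topology in
/-- The fundamental theorem of calculus on `[a, b)` for a nonnegative derivative, with a limit at
the right endpoint. -/
theorem integral_Ioo_of_hasDerivAt_of_nonneg_of_tendsto {f f' : ℝ → ℝ} {a b l : ℝ} (hab : a < b)
    (hderiv : ∀ x ∈ Ico a b, HasDerivAt f (f' x) x) (hpos : ∀ x ∈ Ioo a b, 0 ≤ f' x)
    (hlim : Tendsto f (𝓝[<] b) (𝓝 l)) :
    ∫ x in Ioo a b, f' x = l - f a := by
  have hcont : ContinuousOn (Function.update f b l) (Icc a b) := by
    rw [continuousOn_update_iff, Icc_sdiff_right]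
    exact ⟨fun x hx => (hderiv x hx).continuousAt.continuousWithinAt,
      fun _ => hlim.mono_left (nhdsWithin_mono _ fun x hx => hx.2)⟩
  have hderiv' : ∀ x ∈ Ioo a b, HasDerivAt (Function.update f b l) (f' x) x := fun x hx =>
    (hderiv x ⟨hx.1.le, hx.2⟩).congr_of_eventuallyEq <| by
      filter_upwards [eventually_ne_nhds hx.2.ne] with y hy
      exact Function.update_of_ne hy _ _
  have hint := intervalIntegral.integrableOn_deriv_of_nonneg hcont hderiv' hpos
  rw [← integral_Ioc_eq_integral_Ioo, ← intervalIntegral.integral_of_le hab.le,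
    intervalIntegral.integral_eq_sub_of_hasDerivAt_of_le hab.le hcont hderiv'
      ((intervalIntegrable_iff_integrableOn_Ioc_of_le hab.le).2 hint),
    Function.update_self, Function.update_of_ne hab.ne]

open Filter Topology in
theorem tendsto_quadratic_mul_exp_neg_atTop_nhds_zero (p q r : ℝ) :
    Tendsto (fun u : ℝ => (p + q * u + r * u ^ 2) * Real.exp (-u)) atTop (𝓝 0) := by
  have h := ((Real.tendsto_pow_mul_exp_neg_atTop_nhds_zero 0).const_mul p).add
    (((Real.tendsto_pow_mul_exp_neg_atTop_nhds_zero 1).const_mul q).add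
      ((Real.tendsto_pow_mul_exp_neg_atTop_nhds_zero 2).const_mul r))
  simp only [mul_zero, add_zero] at h
  exact h.congr fun u => by ring

theorem hasDerivAt_tan_mul {a x : ℝ} (h : Real.cos (a * x) ≠ 0) :
    HasDerivAt (fun y => Real.tan (a * y)) (a * (1 + Real.tan (a * x) ^ 2)) x := by
  have h' := (Real.hasDerivAt_tan h).comp x ((hasDerivAt_id x).const_mul a)
  refine h'.congr_deriv ?_
  rw [Real.tan_eq_sin_div_cos]
  field_simp
  rw [Real.cos_sq_add_sin_sq, mul_one]

theorem hasDerivAt_exp_neg_mul_tan_mul {a c x : ℝ} (h : Real.cos (a * x) ≠ 0) :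
    HasDerivAt (fun y => Real.exp (-c * Real.tan (a * y)))
      (-(c * a * (1 + Real.tan (a * x) ^ 2)) * Real.exp (-c * Real.tan (a * x))) x :=
  ((hasDerivAt_tan_mul h).const_mul (-c)).exp.congr_deriv (by ring)

open Set Filter Topology in
/-- The Dirichlet energy of `x ↦ exp (-c * tan (a * x))` up to the first pole of the tangent. -/
theorem integral_deriv_exp_neg_mul_tan_mul_sq {a b c : ℝ} (ha : 0 < a) (hc : 0 < c)
    (hab : a * b = Real.pi / 2) :
    ∫ x in Ioo 0 b, deriv (fun y => Real.exp (-c * Real.tan (a * y))) x ^ 2 =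
      c * a * (1 / 2 + 1 / (4 * c ^ 2)) := by
  have hb : 0 < b := by
    refine pos_of_mul_pos_right ?_ ha.le
    rw [hab]
    exact half_pos Real.pi_pos
  have hcos : ∀ x ∈ Ico 0 b, Real.cos (a * x) ≠ 0 := fun x hx =>
    (Real.cos_pos_of_mem_Ioo ⟨by nlinarith [Real.pi_pos, mul_nonneg ha.le hx.1],
      by rw [← hab]; exact mul_lt_mul_of_pos_left hx.2 ha⟩).ne'
  have hlim : Tendsto (fun x => 2 * c * Real.tan (a * x)) (𝓝[<] b) atTop := by
    refine (Real.tendsto_tan_pi_div_two.comp ?_).const_mul_atTop (by positivity)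
    rw [← hab]
    refine tendsto_nhdsWithin_iff.2 ⟨?_, ?_⟩
    · exact ((continuous_const_mul a).tendsto b).mono_left nhdsWithin_le_nhds
    · filter_upwards [self_mem_nhdsWithin] with x hx
      exact mul_lt_mul_of_pos_left hx ha
  set A : ℝ := c * a * (1 / 2 + 1 / (4 * c ^ 2)) with hA
  have key := integral_Ioo_of_hasDerivAt_of_nonneg_of_tendsto hb
    (f' := fun x => deriv (fun y => Real.exp (-c * Real.tan (a * y))) x ^ 2)
    (fun x hx => ?_) (fun x _ => sq_nonneg _)
    ((tendsto_quadratic_mul_exp_neg_atTop_nhds_zero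
      (-A) (-(a / (4 * c))) (-(a / (8 * c)))).comp hlim)
  · rw [key]
    simp
  · have hu : HasDerivAt (fun y => 2 * c * Real.tan (a * y)) _ x :=
      (hasDerivAt_tan_mul (hcos x hx)).const_mul (2 * c)
    have hF := (((hu.const_mul (-(a / (4 * c)))).const_add (-A)).add
      ((hu.pow 2).const_mul (-(a / (8 * c))))).mul hu.neg.exp
    refine hF.congr_deriv ?_
    rw [(hasDerivAt_exp_neg_mul_tan_mul (hcos x hx)).deriv, mul_pow _ (Real.exp _),
      ← Real.exp_nat_mul,
      show ((2 : ℕ) : ℝ) * (-c * Real.tan (a * x)) = -(2 * c * Real.tan (a * x)) by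
        push_cast; ring]
    simp only [Pi.add_apply, Pi.neg_apply, Pi.pow_apply, hA]
    field_simp
    ring

/-- Threshold for the APS edge state: with g(x) = exp(−(2εΛ/π)·tan(πx/(2ε))),
    the Rayleigh-type expression ∫₀^ε g′² − Λ·g(0)² is negative if and only if
    8ε²Λ² > π², i.e. iff Λ > π/(2√2·ε). -/
theorem stmt_14 (ε Λ : ℝ) (hε : 0 < ε) (hΛ : 0 < Λ) :
    let g : ℝ → ℝ := fun x =>
      Real.exp (-(2 * ε * Λ / Real.pi) * Real.tan (Real.pi * x / (2 * ε)))
    (((∫ x in Set.Ioo 0 ε, (deriv g x) ^ 2) - Λ * (g 0) ^ 2 < 0) ↔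
      8 * ε ^ 2 * Λ ^ 2 > Real.pi ^ 2) ∧
    (((∫ x in Set.Ioo 0 ε, (deriv g x) ^ 2) - Λ * (g 0) ^ 2 < 0) ↔
      Λ > Real.pi / (2 * Real.sqrt 2 * ε)) := by
  intro g
  have hπ := Real.pi_pos
  have hg : g = fun x => Real.exp (-(2 * ε * Λ / Real.pi) * Real.tan (Real.pi / (2 * ε) * x)) := by
    funext x
    simp only [g, div_mul_eq_mul_div]
  have hg0 : g 0 = 1 := by simp [g]
  have hint : ∫ x in Set.Ioo 0 ε, deriv g x ^ 2 =
      Λ * (1 / 2 + Real.pi ^ 2 / (16 * ε ^ 2 * Λ ^ 2)) := by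
    rw [hg, integral_deriv_exp_neg_mul_tan_mul_sq (by positivity) (by positivity)
      (by field_simp)]
    field_simp
    ring
  have hsub : (∫ x in Set.Ioo 0 ε, deriv g x ^ 2) - Λ * g 0 ^ 2 =
      (Real.pi ^ 2 - 8 * ε ^ 2 * Λ ^ 2) / (16 * ε ^ 2 * Λ) := by
    rw [hint, hg0]
    field_simp
    ring
  have hsign : (∫ x in Set.Ioo 0 ε, deriv g x ^ 2) - Λ * g 0 ^ 2 < 0 ↔
      8 * ε ^ 2 * Λ ^ 2 > Real.pi ^ 2 := by
    rw [hsub, div_lt_iff₀ (by positivity), zero_mul, sub_neg, gt_iff_lt]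
  refine ⟨hsign, hsign.trans ?_⟩
  have hsq : 8 * ε ^ 2 * Λ ^ 2 = (Λ * (2 * Real.sqrt 2 * ε)) ^ 2 := by
    rw [mul_pow, mul_pow, mul_pow, Real.sq_sqrt zero_le_two]
    ring
  rw [hsq, gt_iff_lt, gt_iff_lt, div_lt_iff₀ (by positivity),
    sq_lt_sq₀ hπ.le (by positivity)]
end
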